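/- Let (η_t)_{t≥1} be any positive non-decreasing sequence of learning rates. For every horizon T ≥ 1 and every sequence of request patterns (x_t)_{t=1}^T, the regret of the FTPL coded caching policy with learning rates (η_t) satisfies R(T) ≤ (√2·r_max·r_max^C·(|S|−1) / √π) · ∑_{t=1}^T 1/η_t + η_T·G_max + (K²·max{M/N, 1−M/N} / √(2π)) · ∑_{t=1}^T 1/η_t + η_1·G_max + r_max^C. -/

import Mathlib

open MeasureTheory ProbabilityTheory

noncomputable section

namespace CodedCaching

/-- The finite set of feasible cache configurations: binary vectors (entries in `{0,1}`)
with at least `M` ones. -/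
def configs (N M : ℕ) : Finset (Fin N → ℕ) :=
  (Fintype.piFinset fun _ : Fin N => Finset.range 2).filter fun s => M ≤ ∑ i, s i

/-- The finite set of request patterns: `ℕ`-valued vectors whose entries sum to `K`. -/
def requests (N K : ℕ) : Finset (Fin N → ℕ) :=
  (Fintype.piFinset fun _ : Fin N => Finset.range (K + 1)).filter fun x => ∑ i, x i = K

/-- The truncated request vector `y = min(x, 1_N)`, viewed as a real vector. -/
def trunc {N : ℕ} (x : Fin N → ℕ) : Fin N → ℝ := fun i => (min (x i) 1 : ℕ)

/-- The coded part of the expected transmission rate: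
`(⟨s,1⟩/M − 1)·(1 − (1 − M/⟨s,1⟩)^⟨x,s⟩)`. -/
def codedRate {N : ℕ} (M : ℕ) (s x : Fin N → ℕ) : ℝ :=
  ((∑ i, (s i : ℝ)) / M - 1) *
    (1 - (1 - (M : ℝ) / ∑ i, (s i : ℝ)) ^ (∑ i, x i * s i))

/-- The expected transmission rate `K(s,x) = ⟨1_N − s, y⟩ + codedRate`. -/
def rate {N : ℕ} (M : ℕ) (s x : Fin N → ℕ) : ℝ :=
  (∑ i, (1 - (s i : ℝ)) * trunc x i) + codedRate M s x

/-- The common component value of the vector `f(x,s)`: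
`(1/M)·(1 − (1 − M/⟨s,1⟩)^⟨x,s⟩)`. -/
def fcomp {N : ℕ} (M : ℕ) (x s : Fin N → ℕ) : ℝ :=
  (1 / M) * (1 - (1 - (M : ℝ) / ∑ i, (s i : ℝ)) ^ (∑ i, x i * s i))

/-- `r_max`: the maximum of the rate over feasible configurations and request patterns. -/
def rmax (N K M : ℕ) : ℝ :=
  sSup {r : ℝ | ∃ s ∈ configs N M, ∃ x ∈ requests N K, r = rate M s x}

/-- `r_max^C`: the maximum of the coded rate over feasible configurations and requests. -/
def rmaxC (N K M : ℕ) : ℝ :=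
  sSup {r : ℝ | ∃ s ∈ configs N M, ∃ x ∈ requests N K, r = codedRate M s x}

/-- The standard Gaussian measure `N(0, I_N)` on `ℝ^N`. -/
def gauss (N : ℕ) : Measure (Fin N → ℝ) :=
  Measure.pi fun _ => gaussianReal 0 1

/-- The Gaussian width constant `G_max = E_γ[max_{s ∈ S} ⟨s, γ⟩]`. -/
def gmax (N M : ℕ) : ℝ :=
  ∫ γ, sSup {r : ℝ | ∃ s ∈ configs N M, r = ∑ i, (s i : ℝ) * γ i} ∂gauss N

/-- The FTPL objective at time `t` with learning rate `η` and perturbation `γ`: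
`⟨ s − (M/N)·1_N , ∑_{i=1}^{t−1} f(x_i, s) − Y_t + η·γ ⟩` where `Y_t = ∑_{i=1}^{t−1} y_i`. -/
def obj {N : ℕ} (M : ℕ) (x : ℕ → Fin N → ℕ) (η : ℝ) (t : ℕ)
    (γ : Fin N → ℝ) (s : Fin N → ℕ) : ℝ :=
  ∑ j, ((s j : ℝ) - (M : ℝ) / N) *
    ((∑ i ∈ Finset.Ico 1 t, fcomp M (x i) s)
      - (∑ i ∈ Finset.Ico 1 t, trunc (x i) j) + η * γ j)

/-- The FTPL policy: a measurable selection `σ t γ` of a minimizer of the perturbed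
cumulative cost over the feasible configurations, for learning-rate schedule `η`. -/
def IsFTPL {N : ℕ} (M : ℕ) (η : ℕ → ℝ) (x : ℕ → Fin N → ℕ)
    (σ : ℕ → (Fin N → ℝ) → Fin N → ℕ) : Prop :=
  (∀ t, Measurable (σ t)) ∧ (∀ t γ, σ t γ ∈ configs N M) ∧
    ∀ t γ, ∀ s ∈ configs N M, obj M x (η t) t γ (σ t γ) ≤ obj M x (η t) t γ s

/-- The regret of a (randomly perturbed) policy `σ` on the request sequence `x`
over horizon `T`, with respect to the best static configuration in hindsight. -/
def regret {N : ℕ} (M : ℕ) (x : ℕ → Fin N → ℕ)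
    (σ : ℕ → (Fin N → ℝ) → Fin N → ℕ) (T : ℕ) : ℝ :=
  (∑ t ∈ Finset.Icc 1 T, ∫ γ, rate M (σ t γ) (x t) ∂gauss N)
    - sInf {r : ℝ | ∃ s ∈ configs N M, r = ∑ t ∈ Finset.Icc 1 T, rate M s (x t)}

/-- The expected number of cache-configuration switches of the policy `σ` up to time `T`. -/
def switchCount {N : ℕ} (σ : ℕ → (Fin N → ℝ) → Fin N → ℕ) (T : ℕ) : ℝ :=
  ∫ γ, (∑ t ∈ Finset.Icc 1 (T - 1), if σ (t + 1) γ = σ t γ then (0 : ℝ) else 1) ∂gauss N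

/-! ### One-dimensional Gaussian estimates -/

lemma gaussianPDFReal_zero_one_le (z : ℝ) :
    gaussianPDFReal 0 1 z ≤ 1 / Real.sqrt (2 * Real.pi) := by
  rw [gaussianPDFReal_def]
  simp only [NNReal.coe_one, mul_one, sub_zero, one_div]
  refine mul_le_of_le_one_right (by positivity) (Real.exp_le_one_iff.2 ?_)
  have := sq_nonneg z
  linarith

lemma gaussianPDFReal_zero_one_add_le {c z : ℝ} (hc : 0 ≤ c) (hz : -(c / 2) ≤ z) :
    gaussianPDFReal 0 1 (z + c) ≤ gaussianPDFReal 0 1 z := by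
  simp only [gaussianPDFReal_def, NNReal.coe_one, mul_one, sub_zero]
  refine mul_le_mul_of_nonneg_left (Real.exp_le_exp.2 ?_) (by positivity)
  nlinarith

lemma le_gaussianPDFReal_zero_one_add {c z : ℝ} (hc : 0 ≤ c) (hz : z ≤ -(c / 2)) :
    gaussianPDFReal 0 1 z ≤ gaussianPDFReal 0 1 (z + c) := by
  simp only [gaussianPDFReal_def, NNReal.coe_one, mul_one, sub_zero]
  refine mul_le_mul_of_nonneg_left (Real.exp_le_exp.2 ?_) (by positivity)
  nlinarith

lemma intervalIntegral_gaussianPDFReal_le {a b : ℝ} (hab : a ≤ b) :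
    ∫ z in a..b, gaussianPDFReal 0 1 z ≤ (b - a) / Real.sqrt (2 * Real.pi) := by
  calc ∫ z in a..b, gaussianPDFReal 0 1 z
      ≤ ∫ _ in a..b, 1 / Real.sqrt (2 * Real.pi) :=
        intervalIntegral.integral_mono_on hab
          (integrable_gaussianPDFReal 0 1).intervalIntegrable (by simp)
          fun z _ => gaussianPDFReal_zero_one_le z
    _ = (b - a) / Real.sqrt (2 * Real.pi) := by
        rw [intervalIntegral.integral_const, smul_eq_mul, mul_one_div]

lemma gaussianReal_Icc_le {a b : ℝ} (hab : a ≤ b) :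
    gaussianReal 0 1 (Set.Icc a b) ≤ ENNReal.ofReal ((b - a) / Real.sqrt (2 * Real.pi)) := by
  rw [gaussianReal_apply_eq_integral 0 one_ne_zero, integral_Icc_eq_integral_Ioc,
    ← intervalIntegral.integral_of_le hab]
  exact ENNReal.ofReal_le_ofReal (intervalIntegral_gaussianPDFReal_le hab)

/-- A set of reals of diameter at most `δ` has Gaussian measure at most `δ / √(2π)`. -/
lemma gaussianReal_le_of_sub_le {A : Set ℝ} {δ : ℝ} (hδ : 0 ≤ δ)
    (hA : ∀ z ∈ A, ∀ w ∈ A, w - z ≤ δ) :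
    gaussianReal 0 1 A ≤ ENNReal.ofReal (δ / Real.sqrt (2 * Real.pi)) := by
  rcases A.eq_empty_or_nonempty with rfl | ⟨z₀, hz₀⟩
  · simp
  have hbdd : BddBelow A := ⟨z₀ - δ, fun z hz => by linarith [hA z hz z₀ hz₀]⟩
  have hsub : A ⊆ Set.Icc (sInf A) (sInf A + δ) := fun w hw =>
    ⟨csInf_le hbdd hw, by
      have := le_csInf ⟨z₀, hz₀⟩ fun z hz => show w - δ ≤ z by linarith [hA z hz w hw]
      linarith⟩
  calc gaussianReal 0 1 A ≤ gaussianReal 0 1 (Set.Icc (sInf A) (sInf A + δ)) :=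
        measure_mono hsub
    _ ≤ _ := gaussianReal_Icc_le (by linarith)
    _ = _ := by rw [add_sub_cancel_left]

/-- Shifting the argument of a function with values in `[0, ρ]` by `c ≥ 0` changes its
expectation under the standard Gaussian by at most `ρ c / √(2π)`. -/
lemma integral_sub_integral_shift_gaussianReal_le {h : ℝ → ℝ} (hm : Measurable h) {ρ c : ℝ}
    (h0 : ∀ z, 0 ≤ h z) (h1 : ∀ z, h z ≤ ρ) (hc : 0 ≤ c) :
    ∫ z, h z ∂gaussianReal 0 1 - ∫ z, h (z - c) ∂gaussianReal 0 1
      ≤ ρ * (c / Real.sqrt (2 * Real.pi)) := by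
  have hρ : 0 ≤ ρ := (h0 0).trans (h1 0)
  set φ := gaussianPDFReal 0 1 with hφ
  have hi : Integrable φ := integrable_gaussianPDFReal 0 1
  have hic : Integrable fun z => φ (z + c) := hi.comp_add_right c
  have hb : ∀ᵐ z : ℝ, ‖h z‖ ≤ ρ := .of_forall fun z => by
    rw [Real.norm_of_nonneg (h0 z)]; exact h1 z
  have hiφ : Integrable fun z => φ z * h z := by
    simpa only [mul_comm] using hi.bdd_mul hm.aestronglyMeasurable hb
  have hicφ : Integrable fun z => φ (z + c) * h z := by
    simpa only [mul_comm] using hic.bdd_mul hm.aestronglyMeasurable hb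
  have e2 : ∫ z, φ z * h (z - c) = ∫ z, φ (z + c) * h z := by
    rw [← integral_add_right_eq_self (fun z => φ z * h (z - c)) c]
    simp
  have e3 : ∫ z in Set.Ioi (-(c / 2)), φ (z + c) = ∫ z in Set.Ioi (c / 2), φ z := by
    rw [← (measurePreserving_add_right volume c).setIntegral_preimage_emb
      (measurableEmbedding_addRight c) φ, Set.preimage_add_const_Ioi]
    ring_nf
  rw [integral_gaussianReal_eq_integral_smul one_ne_zero,
    integral_gaussianReal_eq_integral_smul one_ne_zero]
  simp only [smul_eq_mul, ← hφ]
  rw [e2, ← integral_sub hiφ hicφ]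
  calc ∫ z, (φ z * h z - φ (z + c) * h z)
      ≤ ∫ z, (Set.Ioi (-(c / 2))).indicator (fun z => ρ * (φ z - φ (z + c))) z := by
        refine integral_mono (hiφ.sub hicφ)
          (((hi.sub hic).const_mul ρ).indicator measurableSet_Ioi) fun z => ?_
        by_cases hz : z ∈ Set.Ioi (-(c / 2))
        · rw [Set.indicator_of_mem hz]
          have := gaussianPDFReal_zero_one_add_le hc (le_of_lt hz)
          nlinarith [h1 z]
        · rw [Set.indicator_of_notMem hz]
          have := le_gaussianPDFReal_zero_one_add hc (not_lt.1 hz)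
          nlinarith [h0 z]
    _ = ρ * ((∫ z in Set.Ioi (-(c / 2)), φ z) - ∫ z in Set.Ioi (c / 2), φ z) := by
        rw [integral_indicator measurableSet_Ioi, integral_const_mul,
          integral_sub hi.integrableOn hic.integrableOn, e3]
    _ = ρ * ∫ z in -(c / 2)..c / 2, φ z := by
        rw [intervalIntegral.integral_Ioi_sub_Ioi hi.integrableOn (by linarith)]
    _ ≤ ρ * (c / Real.sqrt (2 * Real.pi)) := by
        refine mul_le_mul_of_nonneg_left ?_ hρ
        have := intervalIntegral_gaussianPDFReal_le (show -(c / 2) ≤ c / 2 by linarith)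
        rwa [show c / 2 - -(c / 2) = c by ring] at this

/-! ### The standard Gaussian measure on `ℝ^N` -/

instance (N : ℕ) : IsProbabilityMeasure (gauss N) := by
  unfold gauss; infer_instance

/-- Resampling one coordinate preserves the standard Gaussian measure. -/
lemma measurePreserving_update_gauss {N : ℕ} (i : Fin N) :
    MeasurePreserving (fun p : (Fin N → ℝ) × ℝ => Function.update p.1 i p.2)
      ((gauss N).prod (gaussianReal 0 1)) (gauss N) := by
  refine ⟨measurable_update', (Measure.pi_eq fun s hs => ?_).symm⟩
  rw [Measure.map_apply measurable_update' (.univ_pi hs)]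
  have hpre : (fun p : (Fin N → ℝ) × ℝ => Function.update p.1 i p.2) ⁻¹' Set.univ.pi s
      = (Set.univ.pi (Function.update s i Set.univ)) ×ˢ s i := by
    ext p
    simp only [Set.mem_preimage, Set.mem_pi, Set.mem_univ, true_implies, Set.mem_prod]
    constructor
    · refine fun h => ⟨fun j => ?_, by simpa using h i⟩
      rcases eq_or_ne j i with rfl | hj
      · simp
      · simpa [hj] using h j
    · rintro ⟨h, hi⟩ j
      rcases eq_or_ne j i with rfl | hj
      · simpa using hi
      · simpa [hj] using h j
  rw [hpre, Measure.prod_prod, gauss, Measure.pi_pi,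
    ← Finset.mul_prod_erase _ _ (Finset.mem_univ i),
    ← Finset.mul_prod_erase _ (fun j => gaussianReal 0 1 (s j)) (Finset.mem_univ i)]
  simp only [Function.update_self, measure_univ, one_mul]
  rw [mul_comm]
  congr 1
  refine Finset.prod_congr rfl fun j hj => ?_
  rw [Function.update_of_ne (Finset.ne_of_mem_erase hj)]

/-- If every line section of `A` in direction `i` has diameter at most `δ`, then `A` has
Gaussian measure at most `δ / √(2π)`. -/
lemma gauss_real_le_of_section {N : ℕ} (i : Fin N) {A : Set (Fin N → ℝ)} (hA : MeasurableSet A)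
    {δ : ℝ} (hδ : 0 ≤ δ)
    (h : ∀ γ z w, Function.update γ i z ∈ A → Function.update γ i w ∈ A → w - z ≤ δ) :
    (gauss N).real A ≤ δ / Real.sqrt (2 * Real.pi) := by
  refine ENNReal.toReal_le_of_le_ofReal (by positivity) ?_
  rw [← (measurePreserving_update_gauss i).measure_preimage hA.nullMeasurableSet,
    Measure.prod_apply (measurable_update' hA)]
  calc ∫⁻ γ, gaussianReal 0 1 {z | Function.update γ i z ∈ A} ∂gauss N
      ≤ ∫⁻ _, ENNReal.ofReal (δ / Real.sqrt (2 * Real.pi)) ∂gauss N :=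
        lintegral_mono fun γ => gaussianReal_le_of_sub_le hδ fun z hz w hw => h γ z w hz hw
    _ = _ := by simp

lemma integral_sub_integral_shift_single_le {N : ℕ} {g : (Fin N → ℝ) → ℝ} (hg : Measurable g)
    {ρ c : ℝ} (h0 : ∀ γ, 0 ≤ g γ) (h1 : ∀ γ, g γ ≤ ρ) (hc : 0 ≤ c) (i : Fin N) :
    ∫ γ, g γ ∂gauss N - ∫ γ, g (γ - Pi.single i c) ∂gauss N
      ≤ ρ * (c / Real.sqrt (2 * Real.pi)) := by
  have key : ∀ f : (Fin N → ℝ) → ℝ, Measurable f → (∀ γ, 0 ≤ f γ) → (∀ γ, f γ ≤ ρ) →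
      Integrable (fun γ => ∫ z, f (Function.update γ i z) ∂gaussianReal 0 1) (gauss N) ∧
      ∫ γ, f γ ∂gauss N = ∫ γ, ∫ z, f (Function.update γ i z) ∂gaussianReal 0 1 ∂gauss N := by
    intro f hf f0 f1
    have hmp := measurePreserving_update_gauss i
    have hint : Integrable (fun p : (Fin N → ℝ) × ℝ => f (Function.update p.1 i p.2))
        ((gauss N).prod (gaussianReal 0 1)) :=
      Integrable.of_bound (hf.comp measurable_update').aestronglyMeasurable ρ
        (.of_forall fun p => by rw [Real.norm_of_nonneg (f0 _)]; exact f1 _)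
    refine ⟨hint.integral_prod_left, ?_⟩
    rw [← integral_prod _ hint, ← hmp.map_eq,
      integral_map hmp.measurable.aemeasurable hf.aestronglyMeasurable, hmp.map_eq]
  have hsub : ∀ (γ : Fin N → ℝ) z,
      Function.update γ i z - Pi.single i c = Function.update γ i (z - c) := by
    intro γ z
    ext j
    rcases eq_or_ne j i with rfl | hj
    · simp
    · simp [hj]
  obtain ⟨i1, e1⟩ := key g hg h0 h1
  obtain ⟨i2, e2⟩ := key (fun γ => g (γ - Pi.single i c)) (hg.comp (measurable_id.sub_const _))
    (fun _ => h0 _) fun _ => h1 _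
  rw [e1, e2, ← integral_sub i1 i2]
  calc _ ≤ ∫ _, ρ * (c / Real.sqrt (2 * Real.pi)) ∂gauss N := by
        refine integral_mono (i1.sub i2) (integrable_const _) fun γ => ?_
        simp only [hsub]
        exact integral_sub_integral_shift_gaussianReal_le (hg.comp (measurable_update γ))
          (fun _ => h0 _) (fun _ => h1 _) hc
    _ = _ := by simp

/-- Shifting the argument of a function with values in `[0, ρ]` by a nonnegative vector `c`
changes its Gaussian expectation by at most `ρ ‖c‖₁ / √(2π)`. -/
lemma integral_sub_integral_shift_le {N : ℕ} {g : (Fin N → ℝ) → ℝ} (hg : Measurable g)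
    {ρ : ℝ} {c : Fin N → ℝ} (h0 : ∀ γ, 0 ≤ g γ) (h1 : ∀ γ, g γ ≤ ρ) (hc : ∀ i, 0 ≤ c i) :
    ∫ γ, g γ ∂gauss N - ∫ γ, g (γ - c) ∂gauss N
      ≤ ρ * ((∑ i, c i) / Real.sqrt (2 * Real.pi)) := by
  have key : ∀ s : Finset (Fin N),
      ∫ γ, g γ ∂gauss N - ∫ γ, g (γ - ∑ i ∈ s, Pi.single i (c i)) ∂gauss N
        ≤ ρ * ((∑ i ∈ s, c i) / Real.sqrt (2 * Real.pi)) := by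
    intro s
    induction s using Finset.induction_on with
    | empty => simp
    | insert i s hi ih =>
      have := integral_sub_integral_shift_single_le
        (g := fun γ => g (γ - ∑ j ∈ s, Pi.single j (c j)))
        (hg.comp (measurable_id.sub_const _)) (fun _ => h0 _) (fun _ => h1 _) (hc i) i
      simp only [Finset.sum_insert hi, ← sub_sub, add_div, mul_add] at this ⊢
      linarith
  simpa only [Finset.univ_sum_single] using key Finset.univ

/-- The pairing `⟨s, γ⟩` of a configuration with a real vector. -/
def dot {N : ℕ} (s : Fin N → ℕ) (γ : Fin N → ℝ) : ℝ := ∑ i, (s i : ℝ) * γ i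

lemma dot_neg {N : ℕ} (s : Fin N → ℕ) (γ : Fin N → ℝ) : dot s (-γ) = -dot s γ := by
  simp [dot]

lemma dot_smul {N : ℕ} (s : Fin N → ℕ) (c : ℝ) (γ : Fin N → ℝ) :
    dot s (c • γ) = c * dot s γ := by
  simp only [dot, Pi.smul_apply, smul_eq_mul, Finset.mul_sum]
  exact Finset.sum_congr rfl fun i _ => by ring

lemma dot_sub {N : ℕ} (s : Fin N → ℕ) (γ γ' : Fin N → ℝ) :
    dot s (γ - γ') = dot s γ - dot s γ' := by
  simp [dot, mul_sub, Finset.sum_sub_distrib]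

lemma dot_update {N : ℕ} (s : Fin N → ℕ) (γ : Fin N → ℝ) (i : Fin N) (z : ℝ) :
    dot s (Function.update γ i z) = dot s (Function.update γ i 0) + s i * z := by
  simp only [dot, ← Finset.add_sum_erase _ _ (Finset.mem_univ i), Function.update_self,
    mul_zero, zero_add]
  rw [add_comm]
  congr 1
  refine Finset.sum_congr rfl fun j hj => ?_
  rw [Function.update_of_ne (Finset.ne_of_mem_erase hj),
    Function.update_of_ne (Finset.ne_of_mem_erase hj)]

lemma integrable_dot {N : ℕ} (s : Fin N → ℕ) : Integrable (dot s) (gauss N) :=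
  integrable_finsetSum _ fun i _ =>
    (integrable_comp_eval (i := i) (f := fun z : ℝ => z) (μ := fun _ => gaussianReal 0 1)
      ((memLp_id_gaussianReal 1).integrable le_rfl)).const_mul _

lemma integral_dot {N : ℕ} (s : Fin N → ℕ) : ∫ γ, dot s γ ∂gauss N = 0 := by
  have hi : ∀ i : Fin N, Integrable (fun γ : Fin N → ℝ => γ i) (gauss N) := fun i =>
    integrable_comp_eval (i := i) (f := fun z : ℝ => z) (μ := fun _ => gaussianReal 0 1)
      ((memLp_id_gaussianReal 1).integrable le_rfl)
  have h0 : ∀ i : Fin N, ∫ γ, γ i ∂gauss N = 0 := fun i => by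
    rw [gauss, integral_comp_eval (i := i) (f := fun z : ℝ => z)
      (μ := fun _ => gaussianReal 0 1) measurable_id.aestronglyMeasurable,
      integral_id_gaussianReal]
  simp only [dot]
  rw [integral_finsetSum _ fun i _ => (hi i).const_mul _]
  simp [integral_const_mul, h0]

lemma measurePreserving_neg_gauss (N : ℕ) :
    MeasurePreserving (fun γ : Fin N → ℝ => -γ) (gauss N) (gauss N) :=
  measurePreserving_pi (fun _ : Fin N => gaussianReal 0 1) (fun _ => gaussianReal 0 1)
    (f := fun _ z => -z) fun _ => ⟨measurable_neg, by simp [gaussianReal_map_neg]⟩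

/-! ### Stability of perturbed minimizers -/

/-- If two selections minimize the perturbed objectives `F₀ + η⟨·, γ⟩` and `F₁ + η⟨·, γ⟩` over
binary vectors and `F₁ - F₀` has oscillation at most `δ`, then their `i`-th coordinates
disagree with probability at most `δ / (η √(2π))`. -/
lemma gauss_real_coord_ne_le {N : ℕ} {S : Finset (Fin N → ℕ)} (i : Fin N)
    (hS : ∀ s ∈ S, s i ≤ 1) {a b : (Fin N → ℝ) → Fin N → ℕ} (ha : Measurable a)
    (hb : Measurable b) (haS : ∀ γ, a γ ∈ S) (hbS : ∀ γ, b γ ∈ S) {F₀ F₁ : (Fin N → ℕ) → ℝ}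
    {η δ : ℝ} (hη : 0 < η) (hδ0 : 0 ≤ δ)
    (hao : ∀ γ, ∀ s ∈ S, F₀ (a γ) + η * dot (a γ) γ ≤ F₀ s + η * dot s γ)
    (hbo : ∀ γ, ∀ s ∈ S, F₁ (b γ) + η * dot (b γ) γ ≤ F₁ s + η * dot s γ)
    (hδ : ∀ p ∈ S, ∀ q ∈ S, (F₁ p - F₀ p) - (F₁ q - F₀ q) ≤ δ) :
    (gauss N).real {γ | a γ i ≠ b γ i} ≤ δ / η / Real.sqrt (2 * Real.pi) := by
  have hmeas : MeasurableSet {γ | a γ i ≠ b γ i} :=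
    (measurableSet_eq_fun ((measurable_pi_apply i).comp ha)
      ((measurable_pi_apply i).comp hb)).compl
  refine gauss_real_le_of_section i hmeas (by positivity) fun γ z w hz hw => ?_
  have core : ∀ (F G : (Fin N → ℕ) → ℝ) (p q : Fin N → ℕ), p i = 0 → q i = 1 →
      F p + η * dot p (Function.update γ i z) ≤ F q + η * dot q (Function.update γ i z) →
      G q + η * dot q (Function.update γ i w) ≤ G p + η * dot p (Function.update γ i w) →
      (G p - F p) - (G q - F q) ≤ δ → w - z ≤ δ / η := by
    intro F G p q hp hq h1 h2 h3
    rw [dot_update p, dot_update q, hp, hq] at h1 h2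
    rw [le_div_iff₀ hη]
    push_cast at h1 h2
    nlinarith
  set γz := Function.update γ i z
  set γw := Function.update γ i w
  change a γz i ≠ b γz i at hz
  change a γw i ≠ b γw i at hw
  have ha1 := hS _ (haS γz)
  have hb1 := hS _ (hbS γz)
  have ha2 := hS _ (haS γw)
  have hb2 := hS _ (hbS γw)
  rcases (by omega : a γz i = 0 ∨ b γz i = 0) with h0 | h0 <;>
    rcases (by omega : a γw i = 1 ∨ b γw i = 1) with h1 | h1
  · exact core F₀ F₀ _ _ h0 h1 (hao _ _ (haS _)) (hao _ _ (haS _)) (by simpa using hδ0)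
  · exact core F₀ F₁ _ _ h0 h1 (hao _ _ (hbS _)) (hbo _ _ (haS _)) (hδ _ (haS _) _ (hbS _))
  · refine core F₁ F₀ _ _ h0 h1 (hbo _ _ (haS _)) (hao _ _ (hbS _)) ?_
    linarith [hδ _ (haS γw) _ (hbS γz)]
  · exact core F₁ F₁ _ _ h0 h1 (hbo _ _ (hbS _)) (hbo _ _ (hbS _)) (by simpa using hδ0)

/-- Expected change of a `[0, ρ]`-valued function between the minimizers of two perturbed
objectives whose difference has oscillation at most `δ`. -/
lemma integral_sub_integral_minimizer_le {N : ℕ} {S : Finset (Fin N → ℕ)}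
    (hS : ∀ s ∈ S, ∀ i, s i ≤ 1) {a b : (Fin N → ℝ) → Fin N → ℕ} (ha : Measurable a)
    (hb : Measurable b) (haS : ∀ γ, a γ ∈ S) (hbS : ∀ γ, b γ ∈ S) {F₀ F₁ : (Fin N → ℕ) → ℝ}
    {η δ : ℝ} (hη : 0 < η) (hδ0 : 0 ≤ δ)
    (hao : ∀ γ, ∀ s ∈ S, F₀ (a γ) + η * dot (a γ) γ ≤ F₀ s + η * dot s γ)
    (hbo : ∀ γ, ∀ s ∈ S, F₁ (b γ) + η * dot (b γ) γ ≤ F₁ s + η * dot s γ)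
    (hδ : ∀ p ∈ S, ∀ q ∈ S, (F₁ p - F₀ p) - (F₁ q - F₀ q) ≤ δ)
    {h : (Fin N → ℕ) → ℝ} {ρ : ℝ} (h0 : ∀ s ∈ S, 0 ≤ h s) (h1 : ∀ s ∈ S, h s ≤ ρ) :
    ∫ γ, h (a γ) ∂gauss N - ∫ γ, h (b γ) ∂gauss N
      ≤ ρ * (N * (δ / η / Real.sqrt (2 * Real.pi))) := by
  have hρ : 0 ≤ ρ := (h0 _ (haS 0)).trans (h1 _ (haS 0))
  have hint : ∀ {c : (Fin N → ℝ) → Fin N → ℕ}, Measurable c → (∀ γ, c γ ∈ S) →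
      Integrable (fun γ => h (c γ)) (gauss N) := fun hc hcS =>
    Integrable.of_bound ((Measurable.of_discrete (f := h)).comp hc).aestronglyMeasurable ρ
      (.of_forall fun γ => by rw [Real.norm_of_nonneg (h0 _ (hcS γ))]; exact h1 _ (hcS γ))
  let A : Fin N → Set (Fin N → ℝ) := fun i => {γ | a γ i ≠ b γ i}
  have hA : ∀ i, MeasurableSet (A i) := fun i =>
    (measurableSet_eq_fun ((measurable_pi_apply i).comp ha)
      ((measurable_pi_apply i).comp hb)).compl
  have hAi : ∀ i, Integrable ((A i).indicator fun _ => (1 : ℝ)) (gauss N) := fun i =>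
    (integrable_const 1).indicator (hA i)
  rw [← integral_sub (hint ha haS) (hint hb hbS)]
  calc ∫ γ, (h (a γ) - h (b γ)) ∂gauss N
      ≤ ∫ γ, ρ * ∑ i, (A i).indicator (fun _ => (1 : ℝ)) γ ∂gauss N := by
        refine integral_mono ((hint ha haS).sub (hint hb hbS))
          ((integrable_finsetSum _ fun i _ => hAi i).const_mul ρ) fun γ => ?_
        have hnn : ∀ i, 0 ≤ (A i).indicator (fun _ => (1 : ℝ)) γ := fun i =>
          Set.indicator_nonneg (fun _ _ => zero_le_one) _
        by_cases hab : a γ = b γ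
        · simpa [hab] using mul_nonneg hρ (Finset.sum_nonneg fun i _ => hnn i)
        · obtain ⟨i, hi⟩ := Function.ne_iff.1 hab
          have h2 : 1 ≤ ∑ i, (A i).indicator (fun _ => (1 : ℝ)) γ := by
            refine le_trans ?_ (Finset.single_le_sum (fun i _ => hnn i) (Finset.mem_univ i))
            rw [Set.indicator_of_mem (show γ ∈ A i from hi)]
          have := h0 _ (hbS γ)
          have := h1 _ (haS γ)
          dsimp only
          nlinarith
    _ = ρ * ∑ i, (gauss N).real (A i) := by
        rw [integral_const_mul, integral_finsetSum _ fun i _ => hAi i]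
        simp only [integral_indicator_const _ (hA _), smul_eq_mul, mul_one]
    _ ≤ ρ * ∑ _ : Fin N, δ / η / Real.sqrt (2 * Real.pi) :=
        mul_le_mul_of_nonneg_left (Finset.sum_le_sum fun i _ =>
          gauss_real_coord_ne_le i (fun s hs => hS s hs i) ha hb haS hbS hη hδ0 hao hbo hδ) hρ
    _ = _ := by simp

/-! ### Configurations, requests and rates -/

lemma mem_configs {N M : ℕ} {s : Fin N → ℕ} :
    s ∈ configs N M ↔ (∀ i, s i ≤ 1) ∧ M ≤ ∑ i, s i := by
  simp [configs, Fintype.mem_piFinset]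

lemma sum_of_mem_requests {N K : ℕ} {x : Fin N → ℕ} (hx : x ∈ requests N K) :
    ∑ i, x i = K := by
  simp only [requests, Finset.mem_filter] at hx
  exact hx.2

lemma one_mem_configs {N M : ℕ} (hMN : M ≤ N) : (fun _ => 1) ∈ configs N M := by
  simpa [mem_configs] using hMN

lemma card_configs_gt {N M : ℕ} (hMN : M < N) : N + 1 ≤ (configs N M).card := by
  let f : Option (Fin N) → Fin N → ℕ := fun o =>
    o.elim (fun _ => 1) fun i => Function.update (fun _ => 1) i 0
  have hf : Function.Injective f := by
    rintro (_ | i) (_ | j) h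
    · rfl
    · simpa [f] using congrFun h j
    · simpa [f] using congrFun h i
    · by_contra hne
      have hij : i ≠ j := fun e => hne (by rw [e])
      simpa [f, Function.update_of_ne hij] using congrFun h i
  have hmem : ∀ o ∈ (Finset.univ : Finset (Option (Fin N))), f o ∈ configs N M := by
    rintro (_ | i) -
    · exact one_mem_configs hMN.le
    · refine mem_configs.2 ⟨fun j => ?_, ?_⟩
      · rcases eq_or_ne j i with rfl | hj
        · simp [f]
        · simp [f, hj]
      · have : ∑ j, f (some i) j = N - 1 := by
          simp [f, Finset.sum_update_of_mem, Finset.card_sdiff]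
        omega
  simpa using Finset.card_le_card_of_injOn f hmem hf.injOn

lemma trunc_nonneg {N : ℕ} (x : Fin N → ℕ) (i : Fin N) : 0 ≤ trunc x i := by
  simp [trunc]

lemma trunc_le_one {N : ℕ} (x : Fin N → ℕ) (i : Fin N) : trunc x i ≤ 1 := by
  simp only [trunc]; exact_mod_cast min_le_right _ _

lemma trunc_le {N : ℕ} (x : Fin N → ℕ) (i : Fin N) : trunc x i ≤ x i := by
  simp only [trunc]; exact_mod_cast min_le_left _ _

lemma sum_trunc_le_dim {N : ℕ} (x : Fin N → ℕ) : ∑ i, trunc x i ≤ N := by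
  simpa using Finset.sum_le_sum fun i (_ : i ∈ Finset.univ) => trunc_le_one x i

lemma sum_trunc_le {N K : ℕ} {x : Fin N → ℕ} (hx : x ∈ requests N K) :
    ∑ i, trunc x i ≤ K := by
  rw [← sum_of_mem_requests hx]
  push_cast
  exact Finset.sum_le_sum fun i _ => trunc_le x i

section rates

variable {N K M : ℕ} {s x : Fin N → ℕ}

lemma le_sum_of_mem_configs (hs : s ∈ configs N M) : (M : ℝ) ≤ ∑ i, (s i : ℝ) := by
  exact_mod_cast (mem_configs.1 hs).2

lemma sum_le_of_mem_configs (hs : s ∈ configs N M) : ∑ i, (s i : ℝ) ≤ N := by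
  have : ∑ i, (s i : ℝ) ≤ ∑ _ : Fin N, (1 : ℝ) :=
    Finset.sum_le_sum fun i _ => by exact_mod_cast (mem_configs.1 hs).1 i
  simpa using this

lemma codedRate_nonneg (hM : 0 < M) (hs : s ∈ configs N M) (x : Fin N → ℕ) :
    0 ≤ codedRate M s x := by
  have hn := le_sum_of_mem_configs hs
  have hM' : (0 : ℝ) < M := by exact_mod_cast hM
  have h1 : (M : ℝ) / ∑ i, (s i : ℝ) ≤ 1 := div_le_one_of_le₀ hn (by linarith)
  have h2 : 0 ≤ (M : ℝ) / ∑ i, (s i : ℝ) := div_nonneg hM'.le (by linarith)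
  refine mul_nonneg ?_ (sub_nonneg.2 (pow_le_one₀ (by linarith) (by linarith)))
  rw [sub_nonneg, one_le_div hM']
  exact hn

lemma codedRate_le (hM : 0 < M) (hs : s ∈ configs N M) (x : Fin N → ℕ) :
    codedRate M s x ≤ ∑ i, (x i : ℝ) * s i := by
  have hn := le_sum_of_mem_configs hs
  have hM' : (0 : ℝ) < M := by exact_mod_cast hM
  set n := ∑ i, (s i : ℝ) with hndef
  have hn0 : 0 < n := by linarith
  have h1 : (M : ℝ) / n ≤ 1 := div_le_one_of_le₀ hn (by linarith)
  have h2 : 0 ≤ (M : ℝ) / n := div_nonneg hM'.le (by linarith)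
  have h3 : 0 ≤ n / M - 1 := by
    rw [sub_nonneg, one_le_div hM']
    exact hn
  have hbern := one_add_mul_le_pow (a := -((M : ℝ) / n)) (by linarith) (∑ i, x i * s i)
  have hcast : ((∑ i, x i * s i : ℕ) : ℝ) = ∑ i, (x i : ℝ) * s i := by push_cast; rfl
  rw [← sub_eq_add_neg, hcast] at hbern
  have hj : 0 ≤ ∑ i, (x i : ℝ) * s i := Finset.sum_nonneg fun i _ => by positivity
  calc codedRate M s x ≤ (n / M - 1) * ((∑ i, (x i : ℝ) * s i) * (M / n)) := by
        rw [codedRate, ← hndef]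
        exact mul_le_mul_of_nonneg_left (by linarith) h3
    _ = (1 - M / n) * ∑ i, (x i : ℝ) * s i := by field_simp
    _ ≤ ∑ i, (x i : ℝ) * s i := mul_le_of_le_one_left hj (by linarith)

lemma uncoded_nonneg (hs : s ∈ configs N M) (x : Fin N → ℕ) :
    0 ≤ ∑ i, (1 - (s i : ℝ)) * trunc x i :=
  Finset.sum_nonneg fun i _ => mul_nonneg
    (sub_nonneg.2 (by exact_mod_cast (mem_configs.1 hs).1 i)) (trunc_nonneg x i)

lemma rate_nonneg (hM : 0 < M) (hs : s ∈ configs N M) (x : Fin N → ℕ) : 0 ≤ rate M s x :=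
  add_nonneg (uncoded_nonneg hs x) (codedRate_nonneg hM hs x)

lemma rate_le (hM : 0 < M) (hs : s ∈ configs N M) (hx : x ∈ requests N K) :
    rate M s x ≤ K := by
  have h1 : ∑ i, (1 - (s i : ℝ)) * trunc x i ≤ ∑ i, (1 - (s i : ℝ)) * x i :=
    Finset.sum_le_sum fun i _ => mul_le_mul_of_nonneg_left (trunc_le x i)
      (sub_nonneg.2 (by exact_mod_cast (mem_configs.1 hs).1 i))
  have h2 := codedRate_le hM hs x
  have h3 : ∑ i, (1 - (s i : ℝ)) * x i + ∑ i, (x i : ℝ) * s i = K := by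
    rw [← Finset.sum_add_distrib, ← sum_of_mem_requests hx]
    push_cast
    exact Finset.sum_congr rfl fun i _ => by ring
  rw [rate]
  linarith

lemma rate_le_rmax (hM : 0 < M) (hs : s ∈ configs N M) (hx : x ∈ requests N K) :
    rate M s x ≤ rmax N K M :=
  le_csSup ⟨K, by rintro _ ⟨s, hs, x, hx, rfl⟩; exact rate_le hM hs hx⟩ ⟨s, hs, x, hx, rfl⟩

lemma codedRate_le_rmaxC (hM : 0 < M) (hs : s ∈ configs N M) (hx : x ∈ requests N K) :
    codedRate M s x ≤ rmaxC N K M := by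
  refine le_csSup ⟨K, ?_⟩ ⟨s, hs, x, hx, rfl⟩
  rintro _ ⟨s, hs, x, hx, rfl⟩
  exact (le_add_of_nonneg_left (uncoded_nonneg hs x)).trans (rate_le hM hs hx)

lemma rmax_le (hM : 0 < M) (hMN : M ≤ N) (hx : x ∈ requests N K) : rmax N K M ≤ K :=
  csSup_le ⟨_, _, one_mem_configs hMN, x, hx, rfl⟩
    (by rintro _ ⟨s, hs, x, hx, rfl⟩; exact rate_le hM hs hx)

lemma rmax_nonneg (hM : 0 < M) (hMN : M ≤ N) (hx : x ∈ requests N K) : 0 ≤ rmax N K M :=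
  (rate_nonneg hM (one_mem_configs hMN) x).trans (rate_le_rmax hM (one_mem_configs hMN) hx)

lemma rmaxC_nonneg (hM : 0 < M) (hMN : M ≤ N) (hx : x ∈ requests N K) : 0 ≤ rmaxC N K M :=
  (codedRate_nonneg hM (one_mem_configs hMN) x).trans
    (codedRate_le_rmaxC hM (one_mem_configs hMN) hx)

lemma one_sub_div_le_rmaxC (hK : 0 < K) (hM : 0 < M) (hMN : M ≤ N) (hx : x ∈ requests N K) :
    1 - (M : ℝ) / N ≤ rmaxC N K M := by
  refine le_trans ?_ (codedRate_le_rmaxC hM (one_mem_configs hMN) hx)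
  have hM' : (0 : ℝ) < M := by exact_mod_cast hM
  have hMN' : (M : ℝ) ≤ N := by exact_mod_cast hMN
  have hN' : (0 : ℝ) < N := by linarith
  have h1 : (M : ℝ) / N ≤ 1 := div_le_one_of_le₀ hMN' hN'.le
  have h2 : 0 ≤ (M : ℝ) / N := by positivity
  have h3 : 0 ≤ (N : ℝ) / M - 1 := by rwa [sub_nonneg, one_le_div hM']
  have hpow : (1 - (M : ℝ) / N) ^ K ≤ 1 - (M : ℝ) / N :=
    pow_le_of_le_one (by linarith) (by linarith) hK.ne'
  have he : codedRate M (fun _ => 1) x = ((N : ℝ) / M - 1) * (1 - (1 - (M : ℝ) / N) ^ K) := by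
    simp [codedRate, sum_of_mem_requests hx]
  rw [he]
  calc 1 - (M : ℝ) / N = ((N : ℝ) / M - 1) * (M / N) := by field_simp
    _ ≤ _ := mul_le_mul_of_nonneg_left (by linarith) h3

lemma rmaxC_self {x : Fin M → ℕ} (hM : 0 < M) (hx : x ∈ requests M K) : rmaxC M K M = 0 := by
  refine le_antisymm (csSup_le ⟨_, _, one_mem_configs le_rfl, x, hx, rfl⟩ ?_)
    (rmaxC_nonneg hM le_rfl hx)
  rintro _ ⟨s, hs, x, -, rfl⟩
  have h : ∑ i, (s i : ℝ) = M := le_antisymm (sum_le_of_mem_configs hs)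
    (le_sum_of_mem_configs hs)
  have hM' : (M : ℝ) ≠ 0 := by exact_mod_cast hM.ne'
  simp [codedRate, h, div_self hM']

lemma dim_mul_rmaxC_le (hM : 0 < M) (hMN : M ≤ N) (hx : x ∈ requests N K) :
    N * rmaxC N K M ≤ rmaxC N K M * ((configs N M).card - 1) := by
  rcases hMN.eq_or_lt with rfl | hlt
  · simp [rmaxC_self hM hx]
  · rw [mul_comm]
    refine mul_le_mul_of_nonneg_left ?_ (rmaxC_nonneg hM hMN hx)
    have : ((N + 1 : ℕ) : ℝ) ≤ (configs N M).card := by exact_mod_cast card_configs_gt hlt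
    push_cast at this
    linarith

lemma stability_constant_le (hK : 0 < K) (hM : 0 < M) (hMN : M ≤ N) (hx : x ∈ requests N K) :
    rmax N K M * (∑ i, trunc x i) + rmax N K M * (N * rmaxC N K M)
      ≤ 2 * rmax N K M * rmaxC N K M * ((configs N M).card - 1)
        + (K : ℝ) ^ 2 * max ((M : ℝ) / N) (1 - (M : ℝ) / N) := by
  have hr0 := rmax_nonneg hM hMN hx
  have hrK := rmax_le hM hMN hx
  have hd := dim_mul_rmaxC_le hM hMN hx
  have hMN' : (M : ℝ) ≤ N := by exact_mod_cast hMN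
  have hM' : (0 : ℝ) < M := by exact_mod_cast hM
  have hN' : (0 : ℝ) < N := by linarith
  have h1 : (M : ℝ) / N ≤ 1 := div_le_one_of_le₀ hMN' hN'.le
  have h2 : 0 ≤ (M : ℝ) / N := by positivity
  have hc := mul_le_mul_of_nonneg_left (one_sub_div_le_rmaxC hK hM hMN hx) hN'.le
  have hy : ∑ i, trunc x i ≤ N * (1 - (M : ℝ) / N) + K * (M / N) := by
    nlinarith [sum_trunc_le_dim x, sum_trunc_le hx]
  have hA : rmax N K M * (∑ i, trunc x i)
      ≤ rmax N K M * (rmaxC N K M * ((configs N M).card - 1)) + K * (K * (M / N)) :=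
    calc _ ≤ rmax N K M * (rmaxC N K M * ((configs N M).card - 1) + K * (M / N)) :=
          mul_le_mul_of_nonneg_left (by linarith) hr0
      _ ≤ _ := by
          rw [mul_add]
          gcongr
  have hB := mul_le_mul_of_nonneg_left hd hr0
  have hmax : (K : ℝ) ^ 2 * (M / N) ≤ (K : ℝ) ^ 2 * max ((M : ℝ) / N) (1 - (M : ℝ) / N) :=
    mul_le_mul_of_nonneg_left (le_max_left _ _) (by positivity)
  nlinarith

end rates

/-! ### The policy as a perturbed leader -/

/-- The cumulative rate of a static configuration before time `t`. -/
def cumRate {N : ℕ} (M : ℕ) (x : ℕ → Fin N → ℕ) (t : ℕ) (s : Fin N → ℕ) : ℝ :=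
  ∑ i ∈ Finset.Ico 1 t, rate M s (x i)

lemma cumRate_succ {N : ℕ} (M : ℕ) (x : ℕ → Fin N → ℕ) {t : ℕ} (ht : 1 ≤ t) (s : Fin N → ℕ) :
    cumRate M x (t + 1) s = cumRate M x t s + rate M s (x t) :=
  Finset.sum_Ico_succ_top ht _

lemma obj_eq {N M : ℕ} (hN : 0 < N) (hM : 0 < M) (x : ℕ → Fin N → ℕ) (η : ℝ) (t : ℕ)
    (γ : Fin N → ℝ) (s : Fin N → ℕ) :
    obj M x η t γ s = cumRate M x t s + η * dot s γ
      - ((1 - (M : ℝ) / N) * (∑ i ∈ Finset.Ico 1 t, ∑ j, trunc (x i) j)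
        + η * ((M : ℝ) / N) * ∑ j, γ j) := by
  have hN' : (N : ℝ) ≠ 0 := by exact_mod_cast hN.ne'
  have hM' : (M : ℝ) ≠ 0 := by exact_mod_cast hM.ne'
  have hcoded : ∀ i, (∑ j, ((s j : ℝ) - (M : ℝ) / N)) * fcomp M (x i) s
      = codedRate M s (x i) := by
    intro i
    have : ∑ j, ((s j : ℝ) - (M : ℝ) / N) = ∑ j, (s j : ℝ) - M := by
      rw [Finset.sum_sub_distrib]
      simp [mul_div_cancel₀ _ hN']
    rw [this, fcomp, codedRate, ← mul_assoc]
    congr 1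
    field_simp
  have hunc : ∀ i, ∑ j, ((s j : ℝ) - (M : ℝ) / N) * trunc (x i) j
      = (1 - (M : ℝ) / N) * (∑ j, trunc (x i) j) - ∑ j, (1 - (s j : ℝ)) * trunc (x i) j := by
    intro i
    rw [Finset.mul_sum, ← Finset.sum_sub_distrib]
    exact Finset.sum_congr rfl fun j _ => by ring
  have h1 : obj M x η t γ s
      = (∑ j, ((s j : ℝ) - (M : ℝ) / N)) * (∑ i ∈ Finset.Ico 1 t, fcomp M (x i) s)
        - (∑ i ∈ Finset.Ico 1 t, ∑ j, ((s j : ℝ) - (M : ℝ) / N) * trunc (x i) j)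
        + (η * dot s γ - η * ((M : ℝ) / N) * ∑ j, γ j) := by
    rw [Finset.sum_comm, Finset.sum_mul, dot, Finset.mul_sum, Finset.mul_sum,
      ← Finset.sum_sub_distrib, ← Finset.sum_sub_distrib, ← Finset.sum_add_distrib, obj]
    refine Finset.sum_congr rfl fun j _ => ?_
    rw [← Finset.mul_sum]
    ring
  rw [h1, Finset.mul_sum, Finset.sum_congr rfl fun i _ => hcoded i,
    Finset.sum_congr rfl fun i _ => hunc i, Finset.sum_sub_distrib, ← Finset.mul_sum, cumRate]
  simp only [rate, Finset.sum_add_distrib]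
  ring

lemma IsFTPL.optimal {N M : ℕ} (hN : 0 < N) (hM : 0 < M) {η : ℕ → ℝ} {x : ℕ → Fin N → ℕ}
    {σ : ℕ → (Fin N → ℝ) → Fin N → ℕ} (hσ : IsFTPL M η x σ) (t : ℕ) (γ : Fin N → ℝ)
    {s : Fin N → ℕ} (hs : s ∈ configs N M) :
    cumRate M x t (σ t γ) + η t * dot (σ t γ) γ ≤ cumRate M x t s + η t * dot s γ := by
  have := hσ.2.2 t γ s hs
  rw [obj_eq hN hM, obj_eq hN hM] at this
  linarith

/-- A rescaled policy: the minimizer of `cumRate M x (t + 1) + η t * ⟨·, γ⟩`. -/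
lemma IsFTPL.optimal_rescaled {N M : ℕ} (hN : 0 < N) (hM : 0 < M) {η : ℕ → ℝ}
    {x : ℕ → Fin N → ℕ} {σ : ℕ → (Fin N → ℝ) → Fin N → ℕ} (hσ : IsFTPL M η x σ) {t : ℕ}
    (hη : 0 < η (t + 1)) (γ : Fin N → ℝ) {s : Fin N → ℕ} (hs : s ∈ configs N M) :
    cumRate M x (t + 1) (σ (t + 1) ((η t / η (t + 1)) • γ))
        + η t * dot (σ (t + 1) ((η t / η (t + 1)) • γ)) γ
      ≤ cumRate M x (t + 1) s + η t * dot s γ := by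
  have := hσ.optimal hN hM (t + 1) ((η t / η (t + 1)) • γ) hs
  simpa only [dot_smul, ← mul_assoc, mul_div_cancel₀ _ hη.ne'] using this

/-! ### The perturbation term -/

/-- The maximal perturbation `max_{s ∈ S} ⟨s, γ⟩`. -/
def maxPerturb (N M : ℕ) (γ : Fin N → ℝ) : ℝ := sSup {r : ℝ | ∃ s ∈ configs N M, r = dot s γ}

lemma maxPerturb_eq_sup' {N M : ℕ} (h : (configs N M).Nonempty) (γ : Fin N → ℝ) :
    maxPerturb N M γ = (configs N M).sup' h fun s => dot s γ := by
  rw [Finset.sup'_eq_csSup_image, maxPerturb]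
  congr 1
  ext r
  simp [eq_comm]

lemma dot_le_maxPerturb {N M : ℕ} {s : Fin N → ℕ} (hs : s ∈ configs N M) (γ : Fin N → ℝ) :
    dot s γ ≤ maxPerturb N M γ := by
  rw [maxPerturb_eq_sup' ⟨s, hs⟩]
  exact Finset.le_sup' (fun s => dot s γ) hs

lemma integrable_maxPerturb {N M : ℕ} (hMN : M ≤ N) :
    Integrable (maxPerturb N M) (gauss N) := by
  have hne : (configs N M).Nonempty := ⟨_, one_mem_configs hMN⟩
  have : maxPerturb N M = (configs N M).sup' hne dot := by
    ext γ
    rw [maxPerturb_eq_sup' hne, Finset.sup'_apply]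
  rw [this]
  exact Finset.sup'_induction hne dot (p := fun f => Integrable f (gauss N))
    (fun _ hf _ hg => hf.sup hg) fun s _ => integrable_dot s

lemma gmax_eq (N M : ℕ) : gmax N M = ∫ γ, maxPerturb N M γ ∂gauss N := rfl

lemma integrable_maxPerturb_neg {N M : ℕ} (hMN : M ≤ N) :
    Integrable (fun γ => maxPerturb N M (-γ)) (gauss N) :=
  (measurePreserving_neg_gauss N).integrable_comp_of_integrable (integrable_maxPerturb hMN)

lemma integral_maxPerturb_neg (N M : ℕ) :
    ∫ γ, maxPerturb N M (-γ) ∂gauss N = gmax N M :=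
  (measurePreserving_neg_gauss N).integral_comp (MeasurableEquiv.neg _).measurableEmbedding _

lemma gmax_nonneg {N M : ℕ} (hMN : M ≤ N) : 0 ≤ gmax N M := by
  rw [gmax_eq, ← integral_dot (fun _ : Fin N => 1)]
  exact integral_mono (integrable_dot _) (integrable_maxPerturb hMN)
    fun γ => dot_le_maxPerturb (one_mem_configs hMN) γ

/-! ### Regret bound -/

/-- Be-the-leader: if `b t` minimizes `cumRate M x (t + 1) + η t * ⟨·, γ⟩` for each `t`, its
cumulative rate exceeds that of any static configuration only by perturbation terms. -/
lemma sum_rate_leader_le {N M : ℕ} {η : ℕ → ℝ} (hηpos : ∀ t, 1 ≤ t → 0 < η t)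
    (hηmono : ∀ t, 1 ≤ t → η t ≤ η (t + 1)) {x : ℕ → Fin N → ℕ} {γ : Fin N → ℝ}
    {b : ℕ → Fin N → ℕ} (hbS : ∀ t, b t ∈ configs N M)
    (hb : ∀ t, 1 ≤ t → ∀ s ∈ configs N M,
      cumRate M x (t + 1) (b t) + η t * dot (b t) γ ≤ cumRate M x (t + 1) s + η t * dot s γ)
    {T : ℕ} (hT : 1 ≤ T) {s : Fin N → ℕ} (hs : s ∈ configs N M) :
    ∑ t ∈ Finset.Icc 1 T, rate M (b t) (x t)
      ≤ cumRate M x (T + 1) s + η T * dot s γ + η T * maxPerturb N M (-γ) := by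
  have hneg : ∀ t, -dot (b t) γ ≤ maxPerturb N M (-γ) := fun t => by
    rw [← dot_neg]; exact dot_le_maxPerturb (hbS t) _
  induction T, hT using Nat.le_induction generalizing s with
  | base =>
    have h1 := hb 1 le_rfl s hs
    have h2 := mul_le_mul_of_nonneg_left (hneg 1) (hηpos 1 le_rfl).le
    have h3 : cumRate M x (1 + 1) (b 1) = rate M (b 1) (x 1) := by
      simp [cumRate]
    simp only [Finset.Icc_self, Finset.sum_singleton]
    linarith
  | succ T hT ih =>
    rw [Finset.sum_Icc_succ_top (by omega)]
    have h0 := ih (hbS (T + 1))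
    have h1 := hb (T + 1) (by omega) s hs
    rw [cumRate_succ M x (by omega) (b (T + 1))] at h1
    have h2 := mul_le_mul_of_nonneg_left (hneg (T + 1)) (sub_nonneg.2 (hηmono T hT))
    linarith

lemma rate_eq_sum_trunc_sub {N M : ℕ} (s x : Fin N → ℕ) :
    rate M s x = ∑ i, trunc x i - dot s (trunc x) + codedRate M s x := by
  rw [rate, dot, ← Finset.sum_sub_distrib]
  congr 1
  exact Finset.sum_congr rfl fun i _ => by ring

section regret

variable {N K M : ℕ} {η : ℕ → ℝ} {x : ℕ → Fin N → ℕ} {σ : ℕ → (Fin N → ℝ) → Fin N → ℕ}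

lemma integrable_rate_comp (hM : 0 < M) {a : (Fin N → ℝ) → Fin N → ℕ} (ha : Measurable a)
    (haS : ∀ γ, a γ ∈ configs N M) {y : Fin N → ℕ} (hy : y ∈ requests N K) :
    Integrable (fun γ => rate M (a γ) y) (gauss N) :=
  Integrable.of_bound
    ((Measurable.of_discrete (f := fun s => rate M s y)).comp ha).aestronglyMeasurable K
    (.of_forall fun γ => by
      rw [Real.norm_of_nonneg (rate_nonneg hM (haS γ) _)]; exact rate_le hM (haS γ) hy)

lemma stability (hN : 0 < N) (hM : 0 < M) (hMN : M ≤ N) (hx : ∀ t, x t ∈ requests N K)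
    (hσ : IsFTPL M η x σ) {t : ℕ} (ht : 1 ≤ t) (hη : 0 < η t) (hη' : 0 < η (t + 1)) :
    ∫ γ, rate M (σ t γ) (x t) ∂gauss N
        - ∫ γ, rate M (σ (t + 1) ((η t / η (t + 1)) • γ)) (x t) ∂gauss N
      ≤ (rmax N K M * (∑ i, trunc (x t) i) + rmax N K M * (N * rmaxC N K M))
        / Real.sqrt (2 * Real.pi) * (1 / η t) := by
  set c : Fin N → ℝ := fun i => trunc (x t) i / η t with hc
  have hηc : η t • c = trunc (x t) := by
    ext i
    simp [hc, mul_div_cancel₀ _ hη.ne']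
  have h1 : ∫ γ, rate M (σ t γ) (x t) ∂gauss N - ∫ γ, rate M (σ t (γ - c)) (x t) ∂gauss N
      ≤ rmax N K M * ((∑ i, c i) / Real.sqrt (2 * Real.pi)) :=
    integral_sub_integral_shift_le (g := fun γ => rate M (σ t γ) (x t))
      ((Measurable.of_discrete (f := fun s => rate M s (x t))).comp (hσ.1 t))
      (fun γ => rate_nonneg hM (hσ.2.1 t γ) _) (fun γ => rate_le_rmax hM (hσ.2.1 t γ) (hx t))
      fun i => div_nonneg (trunc_nonneg _ i) hη.le
  have h2 := integral_sub_integral_minimizer_le (S := configs N M)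
    (fun s hs => (mem_configs.1 hs).1)
    (a := fun γ => σ t (γ - c)) (b := fun γ => σ (t + 1) ((η t / η (t + 1)) • γ))
    ((hσ.1 t).comp (measurable_id.sub_const c))
    ((hσ.1 (t + 1)).comp (measurable_const_smul _))
    (fun γ => hσ.2.1 _ _) (fun γ => hσ.2.1 _ _)
    (F₀ := fun s => cumRate M x t s - dot s (trunc (x t))) (F₁ := cumRate M x (t + 1))
    hη (rmaxC_nonneg hM hMN (hx t))
    (fun γ s hs => by
      have := hσ.optimal hN hM t (γ - c) hs
      rw [dot_sub, dot_sub, mul_sub, mul_sub, ← dot_smul _ (η t) c, ← dot_smul _ (η t) c,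
        hηc] at this
      linarith)
    (fun γ s hs => hσ.optimal_rescaled hN hM hη' γ hs)
    (fun p hp q hq => by
      have h3 := codedRate_le_rmaxC hM hp (hx t)
      have h4 := codedRate_nonneg hM hq (x t)
      simp only [cumRate_succ M x ht, rate_eq_sum_trunc_sub]
      linarith)
    (h := fun s => rate M s (x t)) (fun s hs => rate_nonneg hM hs _)
    (fun s hs => rate_le_rmax hM hs (hx t))
  have h3 : ∑ i, c i = (∑ i, trunc (x t) i) / η t := (Finset.sum_div _ _ _).symm
  rw [h3] at h1
  calc _ ≤ rmax N K M * ((∑ i, trunc (x t) i) / η t / Real.sqrt (2 * Real.pi))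
        + rmax N K M * (N * (rmaxC N K M / η t / Real.sqrt (2 * Real.pi))) := by linarith
    _ = _ := by ring

end regret

/-- Corollary to Theorem 1: regret bound for the FTPL coded caching policy with an
arbitrary positive non-decreasing learning-rate schedule `(η_t)_{t≥1}`:
`R(T) ≤ (√2·r_max·r_max^C·(|S|−1)/√π)·∑_{t=1}^T 1/η_t + η_T·G_max
  + (K²·max{M/N, 1−M/N}/√(2π))·∑_{t=1}^T 1/η_t + η_1·G_max + r_max^C`. -/
theorem ftpl_regret_general_eta (N K M : ℕ)
    (hN : 0 < N) (hK : 0 < K) (hM : 0 < M) (hMN : M ≤ N)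
    (η : ℕ → ℝ) (hηpos : ∀ t, 1 ≤ t → 0 < η t)
    (hηmono : ∀ t, 1 ≤ t → η t ≤ η (t + 1))
    (x : ℕ → Fin N → ℕ) (hx : ∀ t, x t ∈ requests N K)
    (σ : ℕ → (Fin N → ℝ) → Fin N → ℕ) (hσ : IsFTPL M η x σ)
    (T : ℕ) (hT : 1 ≤ T) :
    regret M x σ T ≤
      Real.sqrt 2 * rmax N K M * rmaxC N K M * (((configs N M).card : ℝ) - 1)
          / Real.sqrt Real.pi * (∑ t ∈ Finset.Icc 1 T, 1 / η t)
        + η T * gmax N M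
        + (K : ℝ) ^ 2 * max ((M : ℝ) / N) (1 - (M : ℝ) / N)
          / Real.sqrt (2 * Real.pi) * (∑ t ∈ Finset.Icc 1 T, 1 / η t)
        + η 1 * gmax N M + rmaxC N K M := by
  have hbS : ∀ t γ, σ (t + 1) ((η t / η (t + 1)) • γ) ∈ configs N M := fun t γ => hσ.2.1 _ _
  have hbint : ∀ t, Integrable
      (fun γ => rate M (σ (t + 1) ((η t / η (t + 1)) • γ)) (x t)) (gauss N) := fun t =>
    integrable_rate_comp hM ((hσ.1 (t + 1)).comp (measurable_const_smul _)) (hbS t) (hx t)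
  have hstab : ∑ t ∈ Finset.Icc 1 T, ∫ γ, rate M (σ t γ) (x t) ∂gauss N
      - ∑ t ∈ Finset.Icc 1 T, ∫ γ, rate M (σ (t + 1) ((η t / η (t + 1)) • γ)) (x t) ∂gauss N
      ≤ (2 * rmax N K M * rmaxC N K M * ((configs N M).card - 1)
          + (K : ℝ) ^ 2 * max ((M : ℝ) / N) (1 - (M : ℝ) / N)) / Real.sqrt (2 * Real.pi)
        * ∑ t ∈ Finset.Icc 1 T, 1 / η t := by
    rw [← Finset.sum_sub_distrib, Finset.mul_sum]
    refine Finset.sum_le_sum fun t ht => ?_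
    have ht1 : 1 ≤ t := (Finset.mem_Icc.1 ht).1
    have hηt := hηpos t ht1
    refine (stability hN hM hMN hx hσ ht1 hηt (hηpos _ (by omega))).trans ?_
    exact mul_le_mul_of_nonneg_right (div_le_div_of_nonneg_right
      (stability_constant_le hK hM hMN (hx t)) (Real.sqrt_nonneg _)) (by positivity)
  have hleader : ∀ s ∈ configs N M,
      ∑ t ∈ Finset.Icc 1 T, ∫ γ, rate M (σ (t + 1) ((η t / η (t + 1)) • γ)) (x t) ∂gauss N
        ≤ ∑ t ∈ Finset.Icc 1 T, rate M s (x t) + η T * gmax N M := by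
    intro s hs
    have i1 : Integrable (fun γ => cumRate M x (T + 1) s + η T * dot s γ) (gauss N) :=
      (integrable_const _).add ((integrable_dot s).const_mul (η T))
    have i2 := (integrable_maxPerturb_neg hMN).const_mul (η T)
    rw [← integral_finsetSum _ fun t _ => hbint t]
    calc _ ≤ ∫ γ, (cumRate M x (T + 1) s + η T * dot s γ + η T * maxPerturb N M (-γ))
            ∂gauss N :=
          integral_mono (integrable_finsetSum _ fun t _ => hbint t) (i1.add i2) fun γ =>
            sum_rate_leader_le hηpos hηmono (fun t => hbS t γ)
              (fun t _ s hs => hσ.optimal_rescaled hN hM (hηpos _ (by omega)) γ hs) hT hs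
      _ = cumRate M x (T + 1) s + η T * gmax N M := by
          rw [integral_add i1 i2, integral_add (integrable_const _)
            ((integrable_dot s).const_mul _), integral_const_mul, integral_const_mul,
            integral_dot, integral_maxPerturb_neg]
          simp
      _ = _ := by rw [cumRate, Finset.Ico_add_one_right_eq_Icc]
  have hinf : ∑ t ∈ Finset.Icc 1 T,
        ∫ γ, rate M (σ (t + 1) ((η t / η (t + 1)) • γ)) (x t) ∂gauss N - η T * gmax N M
      ≤ sInf {r : ℝ | ∃ s ∈ configs N M, r = ∑ t ∈ Finset.Icc 1 T, rate M s (x t)} := by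
    refine le_csInf ⟨_, _, one_mem_configs hMN, rfl⟩ ?_
    rintro _ ⟨s, hs, rfl⟩
    linarith [hleader s hs]
  have hsqrt : Real.sqrt 2 / Real.sqrt Real.pi = 2 / Real.sqrt (2 * Real.pi) := by
    rw [Real.sqrt_mul zero_le_two, ← div_div, Real.div_sqrt]
  have hconst : Real.sqrt 2 * rmax N K M * rmaxC N K M * (((configs N M).card : ℝ) - 1)
      / Real.sqrt Real.pi
      = 2 * rmax N K M * rmaxC N K M * (((configs N M).card : ℝ) - 1)
        / Real.sqrt (2 * Real.pi) := by
    calc _ = Real.sqrt 2 / Real.sqrt Real.pi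
          * (rmax N K M * rmaxC N K M * (((configs N M).card : ℝ) - 1)) := by ring
      _ = _ := by rw [hsqrt]; ring
  have hG := mul_nonneg (hηpos 1 le_rfl).le (gmax_nonneg hMN)
  have hC := rmaxC_nonneg hM hMN (hx 1)
  rw [add_div, add_mul] at hstab
  rw [regret, hconst]
  linarith

end CodedCaching
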